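/- Let m > 0, 0 ≤ x₀ < m, let 𝒢_bd be the set of measurable g : ℝ → ℝ with 𝔼[γ(X)·g(X)] ≥ x₀ and 0 ≤ g(X) ≤ m almost surely, and set q' := inf{VaR_p(g(X)) : g ∈ 𝒢_bd}. Then q' = 0 if and only if m·ES_p(γ(X)) ≥ x₀/(1−p). -/

import Mathlib

open MeasureTheory Filter
open scoped ENNReal Topology Classical

noncomputable def VaR {Ω : Type*} [MeasurableSpace Ω] (P : Measure Ω) (p : ℝ) (Y : Ω → ℝ) : ℝ :=
  sInf {x : ℝ | p ≤ (P {ω | Y ω ≤ x}).toReal}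

noncomputable def ES {Ω : Type*} [MeasurableSpace Ω] (P : Measure Ω) (p : ℝ) (Y : Ω → ℝ) : ℝ :=
  (1 - p)⁻¹ * ∫ u in p..(1 : ℝ), VaR P u Y

/-- The probability space is atomless. -/
def Atomless {Ω : Type*} [MeasurableSpace Ω] (P : Measure Ω) : Prop :=
  ∀ s : Set Ω, MeasurableSet s → 0 < P s →
    ∃ t, t ⊆ s ∧ MeasurableSet t ∧ 0 < P t ∧ P t < P s

/-- The (topological) support of a measure on ℝ. -/
def msupport (μ : Measure ℝ) : Set ℝ :=
  {x | ∀ ε > 0, 0 < μ (Set.Ioo (x - ε) (x + ε))}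

/-- The distribution `μ` has a density (w.r.t. Lebesgue measure) which is positive
on the support of `μ`. -/
def HasPositiveDensityOnSupport (μ : Measure ℝ) : Prop :=
  ∃ f : ℝ → ℝ, Measurable f ∧
    μ = MeasureTheory.volume.withDensity (fun x => ENNReal.ofReal (f x)) ∧
    ∀ x ∈ msupport μ, 0 < f x

/-- The distribution `μ` has a density (w.r.t. Lebesgue measure) which is decreasing
(and positive) on the support of `μ`. -/
def HasDecreasingDensityOnSupport (μ : Measure ℝ) : Prop :=
  ∃ f : ℝ → ℝ, Measurable f ∧
    μ = MeasureTheory.volume.withDensity (fun x => ENNReal.ofReal (f x)) ∧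
    AntitoneOn f (msupport μ) ∧ ∀ x ∈ msupport μ, 0 < f x

/-- Membership in the admissible set 𝒢_cm (complete market): measurable `g` with
budget constraint `𝔼[γ(X)·g(X)] ≥ x₀`. -/
def memGcm {Ω : Type*} [MeasurableSpace Ω] (P : Measure Ω) (X : Ω → ℝ) (γ : ℝ → ℝ)
    (x₀ : ℝ) (g : ℝ → ℝ) : Prop :=
  Measurable g ∧ Integrable (fun ω => γ (X ω) * g (X ω)) P ∧
    x₀ ≤ ∫ ω, γ (X ω) * g (X ω) ∂P

/-- Membership in the admissible set 𝒢_ns (no short-selling):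
`𝔼[γ(X)·g(X)] ≥ x₀` and `0 ≤ g(X) ≤ X` a.s. -/
def memGns {Ω : Type*} [MeasurableSpace Ω] (P : Measure Ω) (X : Ω → ℝ) (γ : ℝ → ℝ)
    (x₀ : ℝ) (g : ℝ → ℝ) : Prop :=
  Measurable g ∧ Integrable (fun ω => γ (X ω) * g (X ω)) P ∧
    x₀ ≤ ∫ ω, γ (X ω) * g (X ω) ∂P ∧
    (∀ᵐ ω ∂P, 0 ≤ g (X ω) ∧ g (X ω) ≤ X ω)

/-- Membership in the admissible set 𝒢_bd (bounded positions):
`𝔼[γ(X)·g(X)] ≥ x₀` and `0 ≤ g(X) ≤ m` a.s. -/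
def memGbd {Ω : Type*} [MeasurableSpace Ω] (P : Measure Ω) (X : Ω → ℝ) (γ : ℝ → ℝ)
    (x₀ m : ℝ) (g : ℝ → ℝ) : Prop :=
  Measurable g ∧ Integrable (fun ω => γ (X ω) * g (X ω)) P ∧
    x₀ ≤ ∫ ω, γ (X ω) * g (X ω) ∂P ∧
    (∀ᵐ ω ∂P, 0 ≤ g (X ω) ∧ g (X ω) ≤ m)

open ProbabilityTheory in
lemma cdf_map_eq {Ω : Type*} [MeasurableSpace Ω] (P : Measure Ω) [IsProbabilityMeasure P]
    {Y : Ω → ℝ} (hY : Measurable Y) (x : ℝ) :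
    cdf (P.map Y) x = (P {ω | Y ω ≤ x}).toReal := by
  have := Measure.isProbabilityMeasure_map (μ := P) hY.aemeasurable
  rw [cdf_eq_real, map_measureReal_apply hY measurableSet_Iic]
  rfl

open ProbabilityTheory in
lemma VaR_le_iff {Ω : Type*} [MeasurableSpace Ω] (P : Measure Ω) [IsProbabilityMeasure P]
    {Y : Ω → ℝ} (hY : Measurable Y) {u : ℝ} (hu : u ∈ Set.Ioo (0 : ℝ) 1) (x : ℝ) :
    VaR P u Y ≤ x ↔ u ≤ cdf (P.map Y) x := by
  have hset : VaR P u Y = sInf {x | u ≤ cdf (P.map Y) x} := by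
    simp only [cdf_map_eq P hY]; rfl
  have hne : {x | u ≤ cdf (P.map Y) x}.Nonempty :=
    ((tendsto_cdf_atTop (P.map Y)).eventually (eventually_ge_nhds hu.2)).exists
  have hbdd : BddBelow {x | u ≤ cdf (P.map Y) x} := by
    obtain ⟨a, ha⟩ :=
      ((tendsto_cdf_atBot (P.map Y)).eventually (eventually_lt_nhds hu.1)).exists
    refine ⟨a, fun y hy => ?_⟩
    by_contra! hlt
    exact absurd (hy.trans (monotone_cdf (P.map Y) hlt.le)) (not_le.2 ha)
  rw [hset]
  refine ⟨fun h => ?_, fun h => csInf_le hbdd h⟩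
  have hlim : Tendsto (cdf (P.map Y)) (𝓝[>] x) (𝓝 (cdf (P.map Y) x)) :=
    ((cdf (P.map Y)).right_continuous x).mono_left (nhdsWithin_mono _ Set.Ioi_subset_Ici_self)
  refine ge_of_tendsto hlim ?_
  filter_upwards [self_mem_nhdsWithin] with y hy
  obtain ⟨z, hz, hzy⟩ := exists_lt_of_csInf_lt hne (h.trans_lt hy)
  exact le_trans hz (monotone_cdf _ hzy.le)

lemma VaR_monotoneOn {Ω : Type*} [MeasurableSpace Ω] (P : Measure Ω) [IsProbabilityMeasure P]
    {Y : Ω → ℝ} (hY : Measurable Y) :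
    MonotoneOn (fun u => VaR P u Y) (Set.Ioo (0 : ℝ) 1) := fun _ hu _ hv huv =>
  (VaR_le_iff P hY hu _).2 (huv.trans ((VaR_le_iff P hY hv _).1 le_rfl))

/-- The quantile function of `Y` has the same law, under the uniform distribution, as `Y`. -/
lemma map_VaR_eq {Ω : Type*} [MeasurableSpace Ω] (P : Measure Ω) [IsProbabilityMeasure P]
    {Y : Ω → ℝ} (hY : Measurable Y) :
    (volume.restrict (Set.Ioo (0 : ℝ) 1)).map (fun u => VaR P u Y) = P.map Y := by
  have := Measure.isProbabilityMeasure_map (μ := P) hY.aemeasurable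
  have hae : AEMeasurable (fun u => VaR P u Y) (volume.restrict (Set.Ioo (0 : ℝ) 1)) :=
    aemeasurable_restrict_of_monotoneOn measurableSet_Ioo (VaR_monotoneOn P hY)
  have : IsFiniteMeasure (volume.restrict (Set.Ioo (0 : ℝ) 1)) := ⟨by simp⟩
  refine Measure.ext_of_Iic _ _ fun x => ?_
  rw [Measure.map_apply_of_aemeasurable hae measurableSet_Iic, ← ProbabilityTheory.ofReal_cdf]
  have h0 := ProbabilityTheory.cdf_nonneg (P.map Y) x
  have h1 := ProbabilityTheory.cdf_le_one (P.map Y) x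
  rw [Measure.restrict_apply₀' measurableSet_Ioo.nullMeasurableSet]
  have hsub : (fun u => VaR P u Y) ⁻¹' Set.Iic x ∩ Set.Ioo 0 1
      = Set.Iic (ProbabilityTheory.cdf (P.map Y) x) ∩ Set.Ioo 0 1 := by
    ext u
    simp only [Set.mem_inter_iff, Set.mem_preimage, Set.mem_Iic]
    exact and_congr_left fun hu => VaR_le_iff P hY hu x
  rw [hsub]
  apply le_antisymm
  · refine (measure_mono (t := Set.Ioc 0 (ProbabilityTheory.cdf (P.map Y) x)) ?_).trans ?_
    · exact fun u hu => ⟨hu.2.1, hu.1⟩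
    · simp
  · refine le_trans ?_ (measure_mono
      (s := Set.Ioo 0 (ProbabilityTheory.cdf (P.map Y) x)) ?_)
    · simp
    · exact fun u hu => ⟨hu.2.le, hu.1, hu.2.trans_le h1⟩

lemma integrable_max_sub_zero {α : Type*} [MeasurableSpace α] {μ : Measure α} [IsFiniteMeasure μ]
    {Y : α → ℝ} (hY : Integrable Y μ) (q : ℝ) : Integrable (fun ω => max (Y ω - q) 0) μ :=
  (hY.sub (integrable_const q)).pos_part

lemma integral_VaR_eq {Ω : Type*} [MeasurableSpace Ω] (P : Measure Ω) [IsProbabilityMeasure P]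
    {Y : Ω → ℝ} (hY : Measurable Y) (hYint : Integrable Y P) {p : ℝ}
    (hp : p ∈ Set.Ioo (0 : ℝ) 1) :
    ∫ u in p..(1 : ℝ), VaR P u Y
      = (1 - p) * VaR P p Y + ∫ ω, max (Y ω - VaR P p Y) 0 ∂P := by
  set q := VaR P p Y with hq
  have : IsFiniteMeasure (volume.restrict (Set.Ioo (0 : ℝ) 1)) := ⟨by simp⟩
  have hae : AEMeasurable (fun u => VaR P u Y) (volume.restrict (Set.Ioo (0 : ℝ) 1)) :=
    aemeasurable_restrict_of_monotoneOn measurableSet_Ioo (VaR_monotoneOn P hY)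
  have hVint : IntegrableOn (fun u => VaR P u Y) (Set.Ioo (0 : ℝ) 1) := by
    have h : Integrable id (P.map Y) :=
      (integrable_map_measure measurable_id.aestronglyMeasurable hY.aemeasurable).2 hYint
    rw [← map_VaR_eq P hY] at h
    exact (integrable_map_measure measurable_id.aestronglyMeasurable hae).1 h
  have hmax : AEStronglyMeasurable (fun y : ℝ => max (y - q) 0) (P.map Y) :=
    (by fun_prop : Measurable fun y : ℝ => max (y - q) 0).aestronglyMeasurable
  have h1 : ∫ ω, max (Y ω - q) 0 ∂P = ∫ u in Set.Ioo (0 : ℝ) 1, max (VaR P u Y - q) 0 := by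
    rw [← integral_map hY.aemeasurable hmax]
    rw [← map_VaR_eq P hY] at hmax ⊢
    rw [integral_map hae hmax]
  have hsub : Set.Ioo p 1 ⊆ Set.Ioo 0 1 := Set.Ioo_subset_Ioo_left hp.1.le
  have h2 : ∫ u in Set.Ioo (0 : ℝ) 1, max (VaR P u Y - q) 0
      = ∫ u in Set.Ioo p 1, max (VaR P u Y - q) 0 := by
    refine setIntegral_eq_of_subset_of_forall_sdiff_eq_zero measurableSet_Ioo hsub ?_
    intro u hu
    have hup : u ≤ p := by
      by_contra! h
      exact hu.2 ⟨h, hu.1.2⟩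
    exact max_eq_right (sub_nonpos.2 (VaR_monotoneOn P hY hu.1 hp hup))
  have h3 : ∫ u in Set.Ioo p 1, max (VaR P u Y - q) 0 = ∫ u in Set.Ioo p 1, (VaR P u Y - q) := by
    refine setIntegral_congr_fun measurableSet_Ioo fun u hu => ?_
    exact max_eq_left (sub_nonneg.2 (VaR_monotoneOn P hY hp (hsub hu) hu.1.le))
  rw [h1, h2, h3, integral_sub (hVint.mono_set hsub) (by simp), intervalIntegral.integral_of_le
    hp.2.le, integral_Ioc_eq_integral_Ioo]
  simp [hp.2.le]

lemma measureReal_VaR_lt_le {Ω : Type*} [MeasurableSpace Ω] (P : Measure Ω)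
    [IsProbabilityMeasure P] {Y : Ω → ℝ} (hY : Measurable Y) {p : ℝ}
    (hp : p ∈ Set.Ioo (0 : ℝ) 1) :
    P.real {ω | VaR P p Y < Y ω} ≤ 1 - p := by
  have h := (VaR_le_iff P hY hp _).1 le_rfl
  rw [cdf_map_eq P hY] at h
  have hc : {ω | VaR P p Y < Y ω} = {ω | Y ω ≤ VaR P p Y}ᶜ := by
    ext ω; simp
  rw [hc, probReal_compl_eq_one_sub (measurableSet_le hY measurable_const)]
  simp only [measureReal_def]
  linarith

lemma le_measureReal_VaR_le {Ω : Type*} [MeasurableSpace Ω] (P : Measure Ω)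
    [IsProbabilityMeasure P] {Y : Ω → ℝ} (hY : Measurable Y) {p : ℝ}
    (hp : p ∈ Set.Ioo (0 : ℝ) 1) :
    1 - p ≤ P.real {ω | VaR P p Y ≤ Y ω} := by
  have := Measure.isProbabilityMeasure_map (μ := P) hY.aemeasurable
  have hlt : P.real {ω | Y ω < VaR P p Y} ≤ p := by
    have h1 : P.real {ω | Y ω < VaR P p Y} = (P.map Y).real (Set.Iio (VaR P p Y)) := by
      rw [map_measureReal_apply hY measurableSet_Iio]; rfl
    rw [h1, measureReal_def, ← ProbabilityTheory.measure_cdf (P.map Y),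
      StieltjesFunction.measure_Iio _ (ProbabilityTheory.tendsto_cdf_atBot _), sub_zero,
      ENNReal.toReal_ofReal', max_le_iff]
    refine ⟨?_, hp.1.le⟩
    refine le_of_tendsto ((ProbabilityTheory.monotone_cdf (P.map Y)).tendsto_leftLim _) ?_
    filter_upwards [self_mem_nhdsWithin] with y hy
    by_contra! h
    exact absurd ((VaR_le_iff P hY hp y).2 h.le) (not_le.2 hy)
  have hc : {ω | VaR P p Y ≤ Y ω} = {ω | Y ω < VaR P p Y}ᶜ := by
    ext ω; simp
  rw [hc, probReal_compl_eq_one_sub (measurableSet_lt hY measurable_const)]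
  linarith

lemma exists_measurableSet_measureReal_eq (ν : Measure ℝ) [IsFiniteMeasure ν] [NullSingletonClass ν] {c : ℝ}
    (hc0 : 0 ≤ c) (hc : c ≤ ν.real Set.univ) : ∃ B, MeasurableSet B ∧ ν.real B = c := by
  rcases hc.eq_or_lt with rfl | hlt
  · exact ⟨_, MeasurableSet.univ, rfl⟩
  have hint : ∀ a b, IntervalIntegrable (fun _ => (1 : ℝ)) ν a b := fun a b => by simp
  have hcont : Continuous fun t : ℝ => ∫ _ in (-t)..t, (1 : ℝ) ∂ν := by
    have h := intervalIntegral.continuous_primitive hint 0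
    have he : (fun t : ℝ => ∫ _ in (-t)..t, (1 : ℝ) ∂ν)
        = fun t => (∫ _ in (0 : ℝ)..t, (1 : ℝ) ∂ν) - ∫ _ in (0 : ℝ)..(-t), (1 : ℝ) ∂ν := by
      ext t
      rw [intervalIntegral.integral_interval_sub_left (hint _ _) (hint _ _)]
    rw [he]
    exact h.sub (h.comp continuous_neg)
  have hlim : Tendsto (fun t : ℝ => ∫ _ in (-t)..t, (1 : ℝ) ∂ν) atTop (𝓝 (ν.real Set.univ)) := by
    have h := intervalIntegral_tendsto_integral (μ := ν) (integrable_const (1 : ℝ))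
      tendsto_neg_atTop_atBot tendsto_id
    simpa using h
  obtain ⟨T, hT0, hT⟩ := ((eventually_ge_atTop (0 : ℝ)).and
    (hlim.eventually (eventually_ge_nhds hlt))).exists
  obtain ⟨t, ht, hteq⟩ := intermediate_value_Icc hT0 hcont.continuousOn
    (show c ∈ Set.Icc _ _ from ⟨by simpa using hc0, hT⟩)
  refine ⟨Set.Ioc (-t) t, measurableSet_Ioc, ?_⟩
  rw [← hteq]
  simp only
  rw [intervalIntegral.integral_of_le (by linarith [ht.1])]
  simp

lemma setIntegral_le_integral_VaR {Ω : Type*} [MeasurableSpace Ω] (P : Measure Ω)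
    [IsProbabilityMeasure P] {Y : Ω → ℝ} (hY : Measurable Y) (hYint : Integrable Y P)
    {p : ℝ} (hp : p ∈ Set.Ioo (0 : ℝ) 1) (hq : 0 ≤ VaR P p Y) {B : Set Ω}
    (hPB : P.real B ≤ 1 - p) :
    ∫ ω in B, Y ω ∂P ≤ ∫ u in p..(1 : ℝ), VaR P u Y := by
  rw [integral_VaR_eq P hY hYint hp]
  set q := VaR P p Y
  have hm := integrable_max_sub_zero hYint q
  calc ∫ ω in B, Y ω ∂P ≤ ∫ ω in B, (q + max (Y ω - q) 0) ∂P := by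
        refine integral_mono hYint.integrableOn
          (((integrable_const q).add hm).integrableOn) fun ω => ?_
        have := le_max_left (Y ω - q) 0
        simp only
        linarith
    _ = P.real B * q + ∫ ω in B, max (Y ω - q) 0 ∂P := by
        rw [integral_add (integrable_const q) hm.integrableOn]
        simp
    _ ≤ _ := by
        exact add_le_add (mul_le_mul_of_nonneg_right hPB hq)
          (setIntegral_le_integral hm (ae_of_all _ fun ω => le_max_right _ _))

lemma setIntegral_eq_integral_VaR {Ω : Type*} [MeasurableSpace Ω] (P : Measure Ω)
    [IsProbabilityMeasure P] {Y : Ω → ℝ} (hY : Measurable Y) (hYint : Integrable Y P)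
    {p : ℝ} (hp : p ∈ Set.Ioo (0 : ℝ) 1) {B : Set Ω} (hB : MeasurableSet B)
    (hPB : P.real B = 1 - p) (hsub : {ω | VaR P p Y < Y ω} ⊆ B)
    (hsup : B ⊆ {ω | VaR P p Y ≤ Y ω}) :
    ∫ ω in B, Y ω ∂P = ∫ u in p..(1 : ℝ), VaR P u Y := by
  rw [integral_VaR_eq P hY hYint hp]
  set q := VaR P p Y
  have hm := integrable_max_sub_zero hYint q
  have h1 : ∫ ω in B, Y ω ∂P = ∫ ω in B, (q + max (Y ω - q) 0) ∂P := by
    refine setIntegral_congr_fun hB fun ω hω => ?_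
    have : max (Y ω - q) 0 = Y ω - q := max_eq_left (sub_nonneg.2 (hsup hω))
    simp only [this]
    ring
  rw [h1, integral_add (integrable_const q) hm.integrableOn,
    setIntegral_eq_integral_of_forall_compl_eq_zero (s := B) (f := fun ω => max (Y ω - q) 0)]
  · simp [hPB]
  · intro ω hω
    refine max_eq_right (sub_nonpos.2 ?_)
    by_contra! h
    exact hω (hsub h)

lemma exists_preimage_between_VaR {Ω : Type*} [MeasurableSpace Ω] (P : Measure Ω)
    [IsProbabilityMeasure P] {X : Ω → ℝ} (hX : Measurable X) [NullSingletonClass (P.map X)] {γ : ℝ → ℝ}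
    (hγ : Measurable γ) {p : ℝ} (hp : p ∈ Set.Ioo (0 : ℝ) 1) :
    ∃ A, MeasurableSet A ∧ P.real (X ⁻¹' A) = 1 - p ∧
      {ω | VaR P p (fun ω => γ (X ω)) < γ (X ω)} ⊆ X ⁻¹' A ∧
      X ⁻¹' A ⊆ {ω | VaR P p (fun ω => γ (X ω)) ≤ γ (X ω)} := by
  have hY : Measurable fun ω => γ (X ω) := hγ.comp hX
  have hlo := measureReal_VaR_lt_le P hY hp
  have hhi := le_measureReal_VaR_le P hY hp
  set q := VaR P p (fun ω => γ (X ω))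
  have := Measure.isProbabilityMeasure_map (μ := P) hX.aemeasurable
  have hgt : MeasurableSet {x | q < γ x} := measurableSet_lt measurable_const hγ
  have heq : MeasurableSet {x | γ x = q} := measurableSet_eq_fun hγ measurable_const
  have hge : P.real {ω | q ≤ γ (X ω)}
      = P.real {ω | q < γ (X ω)} + (P.map X).real {x | γ x = q} := by
    rw [map_measureReal_apply hX heq, ← measureReal_union _ (hX heq)]
    · congr 1
      ext ω
      simp [le_iff_lt_or_eq, eq_comm]
    · exact Set.disjoint_left.2 fun ω h h' => (ne_of_gt h) h'
  obtain ⟨B, hB, hBeq⟩ := exists_measurableSet_measureReal_eq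
    ((P.map X).restrict {x | γ x = q}) (c := 1 - p - P.real {ω | q < γ (X ω)})
    (by linarith) (by simp only [measureReal_restrict_apply_univ]; linarith)
  refine ⟨{x | q < γ x} ∪ (B ∩ {x | γ x = q}), hgt.union (hB.inter heq), ?_, ?_, ?_⟩
  · rw [Set.preimage_union, measureReal_union _ (hX (hB.inter heq)),
      ← map_measureReal_apply hX (hB.inter heq), ← measureReal_restrict_apply hB, hBeq]
    · simp [Set.preimage]
    · exact Set.disjoint_left.2 fun ω h h' => (ne_of_gt h) h'.2
  · exact fun ω h => Or.inl h
  · rintro ω (h | h)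
    · exact (show VaR P p (fun ω => γ (X ω)) < γ (X ω) from h).le
    · exact ge_of_eq h.2

lemma VaR_nonneg {Ω : Type*} [MeasurableSpace Ω] (P : Measure Ω) [IsProbabilityMeasure P]
    {Y : Ω → ℝ} {p : ℝ} (hp : 0 < p) (h0 : ∀ᵐ ω ∂P, 0 ≤ Y ω) : 0 ≤ VaR P p Y := by
  refine Real.sInf_nonneg fun x hx => ?_
  by_contra! hlt
  have hz : P {ω | Y ω ≤ x} = 0 := by
    refine measure_mono_null (fun ω hω => ?_) h0
    simp only [Set.mem_compl_iff, Set.mem_ofPred_eq] at hω ⊢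
    linarith
  simp only [Set.mem_ofPred_eq, hz, ENNReal.toReal_zero] at hx
  linarith

theorem stmt6 {Ω : Type*} [MeasurableSpace Ω] (P : Measure Ω) [IsProbabilityMeasure P]
    (hPatomless : Atomless P)
    (X : Ω → ℝ) (hXmeas : Measurable X) (hXnonneg : ∀ᵐ ω ∂P, 0 ≤ X ω)
    (hXdens : HasPositiveDensityOnSupport (Measure.map X P))
    (γ : ℝ → ℝ) (hγcont : Continuous γ) (hγpos : ∀ x, 0 < γ x)
    (hγint : Integrable (fun ω => γ (X ω)) P)
    (hγ1 : ∫ ω, γ (X ω) ∂P = 1)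
    (hγXint : Integrable (fun ω => γ (X ω) * X ω) P)
    (p : ℝ) (hp : p ∈ Set.Ioo (0 : ℝ) 1)
    (m : ℝ) (hm : 0 < m) (x₀ : ℝ) (hx₀ : 0 ≤ x₀) (hx₀lt : x₀ < m)
    (q' : ℝ)
    (hq' : q' = sInf {v : ℝ | ∃ g : ℝ → ℝ, memGbd P X γ x₀ m g ∧ v = VaR P p (fun ω => g (X ω))}) :
    q' = 0 ↔ x₀ / (1 - p) ≤ m * ES P p (fun ω => γ (X ω)) := by
  have hY : Measurable fun ω => γ (X ω) := hγcont.measurable.comp hXmeas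
  have hq0 : ∀ u, 0 < u → 0 ≤ VaR P u (fun ω => γ (X ω)) := fun u hu =>
    VaR_nonneg P hu (ae_of_all _ fun ω => (hγpos _).le)
  have hp1 : 0 < 1 - p := by linarith [hp.2]
  have hES : x₀ / (1 - p) ≤ m * ES P p (fun ω => γ (X ω))
      ↔ x₀ ≤ m * ∫ u in p..(1 : ℝ), VaR P u (fun ω => γ (X ω)) := by
    rw [ES, div_le_iff₀ hp1]
    field_simp
  rw [hES]
  set S := {v : ℝ | ∃ g : ℝ → ℝ, memGbd P X γ x₀ m g ∧ v = VaR P p (fun ω => g (X ω))}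
  have hS0 : ∀ v ∈ S, 0 ≤ v := by
    rintro v ⟨g, hg, rfl⟩
    exact VaR_nonneg P hp.1 (hg.2.2.2.mono fun ω h => h.1)
  have hSne : S.Nonempty := by
    refine ⟨_, fun _ => m, ⟨measurable_const, hγint.mul_const m, ?_, ?_⟩, rfl⟩
    · rw [integral_mul_const, hγ1]
      linarith
    · exact ae_of_all _ fun ω => ⟨hm.le, le_rfl⟩
  constructor
  · intro h0
    refine le_of_forall_pos_le_add fun ε hε => ?_
    obtain ⟨v, ⟨g, ⟨hgm, hgi, hgx, hgb⟩, rfl⟩, hv⟩ :=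
      exists_lt_of_csInf_lt hSne (show sInf S < ε by rw [← hq', h0]; exact hε)
    have hgX : Measurable fun ω => g (X ω) := hgm.comp hXmeas
    set B := {ω | ε < g (X ω)} with hBdef
    have hB : MeasurableSet B := measurableSet_lt measurable_const hgX
    have hPB : P.real B ≤ 1 - p :=
      (measureReal_mono fun ω (hω : ε < g (X ω)) => hv.trans hω).trans
        (measureReal_VaR_lt_le P hgX hp)
    have hle := setIntegral_le_integral_VaR P hY hγint hp (hq0 p hp.1) hPB
    have hind : Integrable (B.indicator fun ω => γ (X ω)) P := hγint.indicator hB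
    calc x₀ ≤ ∫ ω, γ (X ω) * g (X ω) ∂P := hgx
      _ ≤ ∫ ω, (m * B.indicator (fun ω => γ (X ω)) ω + ε * γ (X ω)) ∂P := by
          refine integral_mono_ae hgi ((hind.const_mul m).add (hγint.const_mul ε)) ?_
          filter_upwards [hgb] with ω hω
          have hpos := hγpos (X ω)
          by_cases hmem : ω ∈ B
          · simp only [Set.indicator_of_mem hmem]
            nlinarith [hω.2, mul_pos hε hpos]
          · simp only [Set.indicator_of_notMem hmem]
            have : g (X ω) ≤ ε := not_lt.1 hmem
            nlinarith
      _ = m * (∫ ω in B, γ (X ω) ∂P) + ε := by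
          rw [integral_add (hind.const_mul m) (hγint.const_mul ε), integral_const_mul,
            integral_const_mul, hγ1, integral_indicator hB, mul_one]
      _ ≤ _ := by gcongr
  · intro h
    have : NullSingletonClass (P.map X) := by
      obtain ⟨f, -, hf, -⟩ := hXdens
      rw [hf]
      infer_instance
    obtain ⟨A, hA, hPA, hsub, hsup⟩ :=
      exists_preimage_between_VaR P hXmeas hγcont.measurable hp
    have hXA : MeasurableSet (X ⁻¹' A) := hXmeas hA
    have hgeq : (fun ω => γ (X ω) * A.indicator (fun _ => m) (X ω))
        = fun ω => m * (X ⁻¹' A).indicator (fun ω => γ (X ω)) ω := by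
      ext ω
      by_cases hω : X ω ∈ A
      · simp [hω, mul_comm]
      · simp [hω]
    have hmem : memGbd P X γ x₀ m (A.indicator fun _ => m) := by
      refine ⟨measurable_const.indicator hA, ?_, ?_, ae_of_all _ fun ω => ?_⟩
      · rw [hgeq]
        exact (hγint.indicator hXA).const_mul m
      · rw [hgeq, integral_const_mul, integral_indicator hXA,
          setIntegral_eq_integral_VaR P hY hγint hp hXA hPA hsub hsup]
        exact h
      · by_cases hω : X ω ∈ A
        · simp [hω, hm.le]
        · simp [hω, hm.le]
    have hVaR : VaR P p (fun ω => A.indicator (fun _ => m) (X ω)) ≤ 0 := by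
      have hgX : Measurable fun ω => A.indicator (fun _ => m) (X ω) :=
        (measurable_const.indicator hA).comp hXmeas
      rw [VaR_le_iff P hgX hp, cdf_map_eq P hgX]
      have hc : {ω | A.indicator (fun _ => m) (X ω) ≤ 0} = (X ⁻¹' A)ᶜ := by
        ext ω
        by_cases hω : X ω ∈ A
        · simp [hω, hm]
        · simp [hω]
      change p ≤ P.real {ω | A.indicator (fun _ => m) (X ω) ≤ 0}
      rw [hc, probReal_compl_eq_one_sub hXA, hPA]
      linarith
    rw [hq']
    exact le_antisymm ((csInf_le ⟨0, hS0⟩ ⟨_, hmem, rfl⟩).trans hVaR) (Real.sInf_nonneg hS0)
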